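/- Let P ∈ ℝ^{N×N} be symmetric positive definite with N = nd + m₀ + nd, ρ ∈ (0,1), L > 0. For each k = 1,…,K let f^k : ℝ^d → ℝ be differentiable and L-smooth with ∇f^k(x^{k,⋆}) = 0, let x_j^k ∈ ℝ^d for j = 1,…,n, and let z^k ∈ ℝ^N and z^{k,⋆} := (x̲^{k,⋆}, 0, ∇^{k,⋆}) ∈ ℝ^N, where x̲^{k,⋆} := (x^{k,⋆},…,x^{k,⋆}) ∈ ℝ^{nd} and ∇^{k,⋆} ∈ ℝ^{nd}, satisfy: (i) ‖z^{k+1} − z^{k,⋆}‖_P ≤ ρ·‖z^k − z^{k,⋆}‖_P for all k; (ii) ‖x̲^k − x̲^{k,⋆}‖ ≤ ‖z^{k+1} − z^{k,⋆}‖ with x̲^k := (x_1^k,…,x_n^k). Then Reg^K := (1/n)·Σ_{j=1}^n Σ_{k=1}^K (f^k(x_j^k) − f^k(x^{k,⋆})) ≤ (4Lρ²·cond(P)/(1 − ρ)²) · ( ‖z^1 − z^{1,⋆}‖² + n·C_{K,2} + D_{K,2} ), where C_{K,2} := Σ_{k=2}^K ‖x^{k,⋆} − x^{k−1,⋆}‖²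 and D_{K,2} := Σ_{k=2}^K ‖∇^{k,⋆} − ∇^{k−1,⋆}‖². -/

import Mathlib

open Matrix Finset

/-- The `P`-norm `‖v‖_P = √(vᵀ P v)`. -/
noncomputable def Pnorm {ι : Type*} [Fintype ι] (P : Matrix ι ι ℝ) (v : ι → ℝ) : ℝ :=
  Real.sqrt (v ⬝ᵥ P.mulVec v)

/-- The Euclidean norm of a finitely supported real vector. -/
noncomputable def vnorm {ι : Type*} [Fintype ι] (v : ι → ℝ) : ℝ :=
  Real.sqrt (v ⬝ᵥ v)

/-- Smallest eigenvalue of a hermitian (real symmetric) matrix. -/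
noncomputable def lamMin {ι : Type*} [Fintype ι] [DecidableEq ι]
    (P : Matrix ι ι ℝ) (hP : P.IsHermitian) : ℝ := ⨅ i, hP.eigenvalues i

/-- Largest eigenvalue of a hermitian (real symmetric) matrix. -/
noncomputable def lamMax {ι : Type*} [Fintype ι] [DecidableEq ι]
    (P : Matrix ι ι ℝ) (hP : P.IsHermitian) : ℝ := ⨆ i, hP.eigenvalues i

section QuadraticForm

variable {ι : Type*} [Fintype ι]

lemma vnorm_sq (v : ι → ℝ) : vnorm v ^ 2 = v ⬝ᵥ v :=
  Real.sq_sqrt (Finset.sum_nonneg fun i _ => mul_self_nonneg (v i))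

lemma vnorm_nonneg (v : ι → ℝ) : 0 ≤ vnorm v := Real.sqrt_nonneg _

lemma Pnorm_nonneg (P : Matrix ι ι ℝ) (v : ι → ℝ) : 0 ≤ Pnorm P v := Real.sqrt_nonneg _

lemma Matrix.PosSemidef.dotProduct_mulVec_self_nonneg {P : Matrix ι ι ℝ} (hP : P.PosSemidef)
    (v : ι → ℝ) : 0 ≤ v ⬝ᵥ P.mulVec v := by
  simpa using hP.dotProduct_mulVec_nonneg v

lemma Pnorm_sq {P : Matrix ι ι ℝ} (hP : P.PosSemidef) (v : ι → ℝ) :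
    Pnorm P v ^ 2 = v ⬝ᵥ P.mulVec v :=
  Real.sq_sqrt (hP.dotProduct_mulVec_self_nonneg v)

lemma Matrix.IsHermitian.dotProduct_mulVec_comm_real {P : Matrix ι ι ℝ} (hP : P.IsHermitian)
    (u v : ι → ℝ) : u ⬝ᵥ P.mulVec v = v ⬝ᵥ P.mulVec u := by
  have hT : Pᵀ = P := by simpa [conjTranspose_eq_transpose_of_trivial] using hP.eq
  rw [dotProduct_mulVec, ← mulVec_transpose, hT, dotProduct_comm]

/-- Young's inequality for the squared `P`-norm of a sum. -/
lemma Pnorm_add_sq_le {P : Matrix ι ι ℝ} (hP : P.PosSemidef) {ρ : ℝ} (hρ0 : 0 < ρ) (hρ1 : ρ < 1)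
    (u v : ι → ℝ) :
    Pnorm P (u + v) ^ 2 ≤ Pnorm P u ^ 2 / ρ + Pnorm P v ^ 2 / (1 - ρ) := by
  have h1ρ : 0 < 1 - ρ := by linarith
  have h := hP.dotProduct_mulVec_self_nonneg ((1 - ρ) • u - ρ • v)
  have hc := hP.isHermitian.dotProduct_mulVec_comm_real v u
  simp only [Pnorm_sq hP]
  simp only [mulVec_sub, mulVec_smul, dotProduct_sub, sub_dotProduct, smul_dotProduct,
    dotProduct_smul, smul_eq_mul, mulVec_add, dotProduct_add, add_dotProduct, hc] at h ⊢
  rw [div_add_div _ _ hρ0.ne' h1ρ.ne', le_div_iff₀ (mul_pos hρ0 h1ρ)]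
  nlinarith

variable [DecidableEq ι]

/-- Simultaneous diagonalization of the quadratic form of `P` and the Euclidean one. -/
lemma Matrix.IsHermitian.exists_dotProduct_mulVec_eq_sum {P : Matrix ι ι ℝ} (hP : P.IsHermitian)
    (v : ι → ℝ) : ∃ w : ι → ℝ, v ⬝ᵥ v = ∑ i, w i ^ 2 ∧
      v ⬝ᵥ P.mulVec v = ∑ i, hP.eigenvalues i * w i ^ 2 := by
  set U : Matrix ι ι ℝ := (hP.eigenvectorUnitary : Matrix ι ι ℝ)
  have hUU : U * Uᵀ = 1 := by
    have := Unitary.mul_star_self_of_mem hP.eigenvectorUnitary.2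
    rwa [star_eq_conjTranspose, conjTranspose_eq_transpose_of_trivial] at this
  have hspec : P = U * diagonal hP.eigenvalues * Uᵀ := by
    have := hP.spectral_theorem
    rw [Unitary.conjStarAlgAut_apply, star_eq_conjTranspose,
      conjTranspose_eq_transpose_of_trivial] at this
    exact this
  have hadj (D : Matrix ι ι ℝ) :
      v ⬝ᵥ (U * D * Uᵀ).mulVec v = (Uᵀ.mulVec v) ⬝ᵥ D.mulVec (Uᵀ.mulVec v) := by
    rw [← mulVec_mulVec, ← mulVec_mulVec, dotProduct_mulVec, mulVec_transpose]
  refine ⟨Uᵀ.mulVec v, ?_, ?_⟩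
  · have := hadj 1
    rw [mul_one, hUU, one_mulVec, one_mulVec] at this
    rw [this]
    simp only [dotProduct, sq]
  · conv_lhs => rw [hspec]
    rw [hadj]
    simp only [dotProduct, mulVec_diagonal]
    exact Finset.sum_congr rfl fun i _ => by ring

lemma Pnorm_sq_le_lamMax_mul {P : Matrix ι ι ℝ} (hP : P.PosSemidef) (v : ι → ℝ) :
    Pnorm P v ^ 2 ≤ lamMax P hP.1 * vnorm v ^ 2 := by
  obtain ⟨w, h1, h2⟩ := hP.1.exists_dotProduct_mulVec_eq_sum v
  rw [Pnorm_sq hP, vnorm_sq, h1, h2, Finset.mul_sum]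
  gcongr with i
  exact le_ciSup (Set.finite_range _).bddAbove i

lemma lamMin_mul_le_Pnorm_sq {P : Matrix ι ι ℝ} (hP : P.PosSemidef) (v : ι → ℝ) :
    lamMin P hP.1 * vnorm v ^ 2 ≤ Pnorm P v ^ 2 := by
  obtain ⟨w, h1, h2⟩ := hP.1.exists_dotProduct_mulVec_eq_sum v
  rw [Pnorm_sq hP, vnorm_sq, h1, h2, Finset.mul_sum]
  gcongr with i
  exact ciInf_le (Set.finite_range _).bddBelow i

lemma lamMin_nonneg {P : Matrix ι ι ℝ} (hP : P.PosSemidef) : 0 ≤ lamMin P hP.1 :=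
  Real.iInf_nonneg hP.eigenvalues_nonneg

lemma lamMax_nonneg {P : Matrix ι ι ℝ} (hP : P.PosSemidef) : 0 ≤ lamMax P hP.1 :=
  Real.iSup_nonneg hP.eigenvalues_nonneg

lemma lamMin_pos [Nonempty ι] {P : Matrix ι ι ℝ} (hP : P.PosDef) : 0 < lamMin P hP.1 := by
  obtain ⟨i, hi⟩ := exists_eq_ciInf_of_finite (f := hP.1.eigenvalues)
  rw [lamMin, ← hi]
  exact hP.eigenvalues_pos i

lemma vnorm_sq_le_Pnorm_sq_div_lamMin {P : Matrix ι ι ℝ} (hP : P.PosDef) (v : ι → ℝ) :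
    vnorm v ^ 2 ≤ Pnorm P v ^ 2 / lamMin P hP.1 := by
  cases isEmpty_or_nonempty ι
  · simp [vnorm, Pnorm]
  · rw [le_div_iff₀' (lamMin_pos hP)]
    exact lamMin_mul_le_Pnorm_sq hP.posSemidef v

end QuadraticForm

/-- A function with Lipschitz gradient grows at most quadratically around a critical point. -/
lemma sub_le_mul_sq_norm_of_gradient_eq_zero {E : Type*} [NormedAddCommGroup E]
    [InnerProductSpace ℝ E] [CompleteSpace E] {f : E → ℝ} {L : ℝ} (hL : 0 ≤ L)
    (hf : Differentiable ℝ f)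
    (hsmooth : ∀ w v, ‖gradient f w - gradient f v‖ ≤ L * ‖w - v‖) {a : E}
    (ha : gradient f a = 0) (y : E) : f y - f a ≤ L * ‖y - a‖ ^ 2 := by
  have h := Convex.norm_image_sub_le_of_norm_fderiv_le (𝕜 := ℝ) (f := f) (C := L * ‖y - a‖)
    (s := Metric.closedBall a ‖y - a‖) (x := a) (y := y) (fun w _ => hf w)
    (fun w hw => by
      rw [← toDual_gradient, LinearIsometryEquiv.norm_map]
      have := hsmooth w a
      rw [ha, sub_zero] at this
      refine this.trans ?_
      gcongr
      simpa [dist_eq_norm] using hw)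
    (convex_closedBall _ _) (Metric.mem_closedBall_self (norm_nonneg _))
    (by simp [dist_eq_norm])
  calc f y - f a ≤ ‖f y - f a‖ := Real.le_norm_self _
    _ ≤ _ := h
    _ = _ := by ring

/-- Summed form of the linear recursion `a (k + 1) ≤ ρ * a k + e (k + 1) / (1 - ρ)`. -/
lemma sum_Icc_le_of_contraction {ρ : ℝ} (hρ0 : 0 ≤ ρ) (hρ1 : ρ < 1) {a e : ℕ → ℝ}
    (ha : ∀ k, 0 ≤ a k) (hrec : ∀ k, a (k + 1) ≤ ρ * a k + e (k + 1) / (1 - ρ)) (K : ℕ) :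
    ∑ k ∈ Finset.Icc 1 K, a k ≤ (a 1 + ∑ k ∈ Finset.Icc 2 K, e k) / (1 - ρ) ^ 2 := by
  have h1ρ : 0 < 1 - ρ := by linarith
  have key (n : ℕ) : (1 - ρ) * ∑ k ∈ Finset.Icc 1 (n + 1), a k + ρ * a (n + 1) ≤
      a 1 + (∑ k ∈ Finset.Icc 2 (n + 1), e k) / (1 - ρ) := by
    induction n with
    | zero => simp; linarith
    | succ n ih =>
      rw [Finset.sum_Icc_succ_top (b := n + 1) (by omega),
        Finset.sum_Icc_succ_top (b := n + 1) (by omega), add_div]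
      linarith [hrec (n + 1)]
  rw [le_div_iff₀ (by positivity)]
  cases K with
  | zero => simpa using ha 1
  | succ n =>
    have h := mul_le_mul_of_nonneg_left (key n) h1ρ.le
    rw [mul_add, mul_add, mul_div_cancel₀ _ h1ρ.ne'] at h
    nlinarith [mul_nonneg h1ρ.le (mul_nonneg hρ0 (ha (n + 1))), mul_nonneg hρ0 (ha 1)]

/-- **Explicit regret bound (eq. (47), Appendix G).** For the block-structured fixed
point `z^{k,⋆} = (x̲^{k,⋆}, 0, ∇^{k,⋆})`, the dynamic regret of GGT satisfies
`Reg^K ≤ (4Lρ²·cond(P)/(1-ρ)²)·(‖z^1 - z^{1,⋆}‖² + n·C_{K,2} + D_{K,2})`. -/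
theorem ggt_regret_condition_number {d n m₀ : ℕ}
    (P : Matrix ((Fin n × Fin d) ⊕ Fin m₀ ⊕ (Fin n × Fin d))
      ((Fin n × Fin d) ⊕ Fin m₀ ⊕ (Fin n × Fin d)) ℝ) (hP : P.PosDef)
    (ρ L : ℝ) (hρ0 : 0 < ρ) (hρ1 : ρ < 1) (hL : 0 < L) (K : ℕ)
    (f : ℕ → EuclideanSpace ℝ (Fin d) → ℝ)
    (xs : ℕ → EuclideanSpace ℝ (Fin d))
    (x : ℕ → Fin n → EuclideanSpace ℝ (Fin d))
    (gs : ℕ → (Fin n × Fin d) → ℝ)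
    (hdiff : ∀ k, Differentiable ℝ (f k))
    (hsmooth : ∀ k, ∀ w v : EuclideanSpace ℝ (Fin d),
      ‖gradient (f k) w - gradient (f k) v‖ ≤ L * ‖w - v‖)
    (hgrad0 : ∀ k, gradient (f k) (xs k) = 0)
    (z zs : ℕ → ((Fin n × Fin d) ⊕ Fin m₀ ⊕ (Fin n × Fin d)) → ℝ)
    (hzs : ∀ k, zs k =
      Sum.elim (fun q : Fin n × Fin d => xs k q.2) (Sum.elim 0 (gs k)))
    (hcontract : ∀ k, Pnorm P (z (k + 1) - zs k) ≤ ρ * Pnorm P (z k - zs k))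
    (hsub : ∀ k, vnorm (fun q : Fin n × Fin d => x k q.1 q.2 - xs k q.2) ≤
      vnorm (z (k + 1) - zs k)) :
    (1 / (n : ℝ)) * ∑ j : Fin n, ∑ k ∈ Finset.Icc 1 K, (f k (x k j) - f k (xs k)) ≤
      4 * L * ρ ^ 2 * (lamMax P hP.1 / lamMin P hP.1) / (1 - ρ) ^ 2 *
        ((vnorm (z 1 - zs 1)) ^ 2
          + n * ∑ k ∈ Finset.Icc 2 K, ‖xs k - xs (k - 1)‖ ^ 2
          + ∑ k ∈ Finset.Icc 2 K, (vnorm (gs k - gs (k - 1))) ^ 2) := by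
  have hps := hP.posSemidef
  have h1ρ : 0 < 1 - ρ := by linarith
  have hmin := lamMin_nonneg hps
  have hmax := lamMax_nonneg hps
  set C := ∑ k ∈ Finset.Icc 2 K, ‖xs k - xs (k - 1)‖ ^ 2 with hC
  set D := ∑ k ∈ Finset.Icc 2 K, (vnorm (gs k - gs (k - 1))) ^ 2 with hD
  set S := vnorm (z 1 - zs 1) ^ 2 + n * C + D with hS
  have hS0 : 0 ≤ S := by positivity
  have hzs_diff (k l : ℕ) : vnorm (zs k - zs l) ^ 2 =
      n * ‖xs k - xs l‖ ^ 2 + vnorm (gs k - gs l) ^ 2 := by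
    rw [vnorm_sq, vnorm_sq, hzs, hzs, EuclideanSpace.real_norm_sq_eq]
    simp [dotProduct, Fintype.sum_sum_type, Fintype.sum_prod_type, sq]
  have hcontract_sq (k : ℕ) :
      Pnorm P (z (k + 1) - zs k) ^ 2 ≤ ρ ^ 2 * Pnorm P (z k - zs k) ^ 2 := by
    rw [← mul_pow]
    exact pow_le_pow_left₀ (Pnorm_nonneg _ _) (hcontract k) 2
  have hrec (k : ℕ) : Pnorm P (z (k + 1) - zs (k + 1)) ^ 2 ≤
      ρ * Pnorm P (z k - zs k) ^ 2 + Pnorm P (zs k - zs (k + 1)) ^ 2 / (1 - ρ) := by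
    have h := Pnorm_add_sq_le hps hρ0 hρ1 (z (k + 1) - zs k) (zs k - zs (k + 1))
    rw [sub_add_sub_cancel] at h
    refine h.trans ?_
    gcongr
    rw [div_le_iff₀ hρ0]
    linarith [hcontract_sq k]
  have hsum : ∑ k ∈ Finset.Icc 1 K, Pnorm P (z k - zs k) ^ 2 ≤
      lamMax P hP.1 * S / (1 - ρ) ^ 2 := by
    refine (sum_Icc_le_of_contraction hρ0.le hρ1 (a := fun k => Pnorm P (z k - zs k) ^ 2)
      (e := fun k => Pnorm P (zs (k - 1) - zs k) ^ 2) (fun k => sq_nonneg _) hrec K).trans ?_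
    gcongr
    calc _ ≤ lamMax P hP.1 * vnorm (z 1 - zs 1) ^ 2 +
          ∑ k ∈ Finset.Icc 2 K, lamMax P hP.1 * vnorm (zs (k - 1) - zs k) ^ 2 := by
            gcongr <;> exact Pnorm_sq_le_lamMax_mul hps _
      _ = lamMax P hP.1 * S := by
            have hterm (k : ℕ) : vnorm (zs (k - 1) - zs k) ^ 2 =
                n * ‖xs k - xs (k - 1)‖ ^ 2 + vnorm (gs k - gs (k - 1)) ^ 2 := by
              rw [← hzs_diff, vnorm_sq, vnorm_sq, ← neg_sub (zs k), neg_dotProduct_neg]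
            simp only [hterm, ← Finset.mul_sum, Finset.sum_add_distrib, hS, hC, hD]
            ring
  have hstep (k : ℕ) : ∑ j, (f k (x k j) - f k (xs k)) ≤
      L * (ρ ^ 2 * Pnorm P (z k - zs k) ^ 2 / lamMin P hP.1) := by
    calc ∑ j, (f k (x k j) - f k (xs k)) ≤ ∑ j, L * ‖x k j - xs k‖ ^ 2 := by
          gcongr with j
          exact sub_le_mul_sq_norm_of_gradient_eq_zero hL.le (hdiff k) (hsmooth k) (hgrad0 k) _
      _ = L * vnorm (fun q : Fin n × Fin d => x k q.1 q.2 - xs k q.2) ^ 2 := by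
          rw [vnorm_sq, ← Finset.mul_sum]
          simp only [EuclideanSpace.real_norm_sq_eq, dotProduct, Fintype.sum_prod_type, ← sq,
            PiLp.sub_apply]
      _ ≤ L * vnorm (z (k + 1) - zs k) ^ 2 := by
          gcongr
          · exact vnorm_nonneg _
          · exact hsub k
      _ ≤ L * (Pnorm P (z (k + 1) - zs k) ^ 2 / lamMin P hP.1) := by
          gcongr
          exact vnorm_sq_le_Pnorm_sq_div_lamMin hP _
      _ ≤ _ := by
          gcongr
          exact hcontract_sq k
  have htotal : ∑ j : Fin n, ∑ k ∈ Finset.Icc 1 K, (f k (x k j) - f k (xs k)) ≤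
      L * ρ ^ 2 * (lamMax P hP.1 / lamMin P hP.1) / (1 - ρ) ^ 2 * S := by
    rw [Finset.sum_comm]
    calc _ ≤ ∑ k ∈ Finset.Icc 1 K, L * (ρ ^ 2 * Pnorm P (z k - zs k) ^ 2 / lamMin P hP.1) :=
          Finset.sum_le_sum fun k _ => hstep k
      _ = L * (ρ ^ 2 * (∑ k ∈ Finset.Icc 1 K, Pnorm P (z k - zs k) ^ 2) / lamMin P hP.1) := by
          rw [Finset.mul_sum, Finset.sum_div, Finset.mul_sum]
      _ ≤ L * (ρ ^ 2 * (lamMax P hP.1 * S / (1 - ρ) ^ 2) / lamMin P hP.1) := by gcongr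
      _ = _ := by ring
  have hB : 0 ≤ L * ρ ^ 2 * (lamMax P hP.1 / lamMin P hP.1) / (1 - ρ) ^ 2 * S := by positivity
  have hn : (1 / (n : ℝ)) ≤ 1 := by
    rw [one_div]
    exact Nat.cast_inv_le_one n
  calc _ ≤ 1 / (n : ℝ) * (L * ρ ^ 2 * (lamMax P hP.1 / lamMin P hP.1) / (1 - ρ) ^ 2 * S) := by
        gcongr
    _ ≤ 1 * (L * ρ ^ 2 * (lamMax P hP.1 / lamMin P hP.1) / (1 - ρ) ^ 2 * S) := by gcongr
    _ ≤ 4 * (L * ρ ^ 2 * (lamMax P hP.1 / lamMin P hP.1) / (1 - ρ) ^ 2 * S) := by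
        gcongr
        norm_num
    _ = _ := by ring
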